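/- arXiv:1807.01064 — 3 statements merged into one kernel-verified Lean document; each statement's English description precedes it below -/
import Mathlib

section
/- Let d, r, a be integers with 5 ≤ d ≤ r + 2 and 2 ≤ a ≤ d - 1. Then there exists a real constant η > 0, depending only on d and r, such that for every finite field F with q = |F| and every positive integer n with n ≡ a (mod r+1), q(r+1) < n, and (as real numbers) n ≤ η · q^(1 + 1/⌊(d-3)/2⌋), there exists a linear code C of length n over F such that: (i) C has locality r; (ii) the dimension k = Module.finrank F C satisfies k ≥ n - ⌈n/(r+1)⌉ - (d-2); (iii) every nonzero codeword of C has Hamming weight at least d; and (iv) every nonzero codeword of C has Hamming weight at least n - k - ⌈k/r⌉ + 1 (with ⌈·⌉ denoting ceilings of the corresponding rationals). -/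
/-- The dual code of a linear code `C ⊆ F^n`. -/
def dualCode {F : Type*} [Field F] {n : ℕ} (C : Submodule F (Fin n → F)) :
    Set (Fin n → F) :=
  {v | ∀ c ∈ C, ∑ i, v i * c i = 0}

/-- `C` has locality `r`: every coordinate `i` has a dual codeword `v` with `v i ≠ 0`
whose support has size at most `r + 1`. -/
def HasLocality {F : Type*} [Field F] [DecidableEq F] {n : ℕ}
    (C : Submodule F (Fin n → F)) (r : ℕ) : Prop :=
  ∀ i : Fin n, ∃ v ∈ dualCode C, v i ≠ 0 ∧ hammingNorm v ≤ r + 1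

/-- `d` is the minimum Hamming distance (= least weight of a nonzero codeword) of `C`. -/
def IsMinDist {F : Type*} [Field F] [DecidableEq F] {n : ℕ}
    (C : Submodule F (Fin n → F)) (d : ℕ) : Prop :=
  IsLeast {w : ℕ | ∃ c ∈ C, c ≠ 0 ∧ hammingNorm c = w} d

/-- The graph joining two distinct points lying in a common block `S j` with `j < M`. -/
def blockGraph {V : Type*} (S : ℕ → Finset V) (M : ℕ) : SimpleGraph V where
  Adj x y := x ≠ y ∧ ∃ j < M, x ∈ S j ∧ y ∈ S j
  symm := ⟨fun _ _ ⟨h, j, hj, hx, hy⟩ => ⟨h.symm, j, hj, hy, hx⟩⟩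
  loopless := ⟨fun _ h => h.1 rfl⟩

/-- Each new block meets the earlier ones in points which earlier blocks do not join by a walk of
length at most `s`. -/
def HasLargeGirth {V : Type*} (S : ℕ → Finset V) (s M : ℕ) : Prop :=
  ∀ i < M, ∀ x ∈ S i, ∀ y ∈ S i, x ≠ y →
    ∀ p : (blockGraph S i).Walk x y, s < p.length

/-- Subsets of the blocks in a family of large girth, spanning few points, cannot have all but one
of their points covered twice. -/
theorem HasLargeGirth.subfamily_eq_empty {V : Type*} {S : ℕ → Finset V} {s : ℕ}
    {P : Finset V} (hP : P.card ≤ s + 1) (M : ℕ) (hS : HasLargeGirth S s M)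
    (A : ℕ → Finset V) (hAS : ∀ i, A i ⊆ S i) (hAP : ∀ i, A i ⊆ P)
    (hAM : ∀ i, M ≤ i → A i = ∅) (hA1 : ∀ i, (A i).card ≠ 1) (e : V)
    (he : ∀ x, x ≠ e → ∀ i, x ∈ A i → ∃ j, j ≠ i ∧ x ∈ A j) (i : ℕ) : A i = ∅ := by
  classical
  induction M generalizing A e i with
  | zero => exact hAM i (Nat.zero_le i)
  | succ M ih =>
    have hS' : HasLargeGirth S s M := fun i hi => hS i (hi.trans (Nat.lt_succ_self M))
    by_cases hlast : A M = ∅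
    · refine ih hS' A hAS hAP (fun k hk => ?_) hA1 e he i
      rcases hk.eq_or_lt with rfl | hk
      · exact hlast
      · exact hAM k hk
    exfalso
    let H : SimpleGraph P := (blockGraph A M).comap Subtype.val
    have hadj : ∀ {k : ℕ} {z w : V} (hz : z ∈ A k) (hw : w ∈ A k), k < M →
        H.Reachable ⟨z, hAP k hz⟩ ⟨w, hAP k hw⟩ := by
      intro k z w hz hw hk
      by_cases h : z = w
      · subst h; rfl
      · exact SimpleGraph.Adj.reachable (show H.Adj _ _ from ⟨h, k, hk, hz, hw⟩)
    have hfar : ∀ {x y : V} (hx : x ∈ A M) (hy : y ∈ A M), x ≠ y →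
        ¬ H.Reachable ⟨x, hAP M hx⟩ ⟨y, hAP M hy⟩ := by
      intro x y hx hy hxy hr
      obtain ⟨p, hp⟩ := hr.exists_isPath
      have hlen := hp.length_lt
      rw [Fintype.card_coe] at hlen
      let φ : H →g blockGraph S M :=
        ⟨Subtype.val, fun {a b} h =>
          ⟨h.1, h.2.imp fun j hj => ⟨hj.1, hAS j hj.2.1, hAS j hj.2.2⟩⟩⟩
      have := hS M (Nat.lt_succ_self M) x (hAS M hx) y (hAS M hy) hxy (p.map φ)
      rw [SimpleGraph.Walk.length_map] at this
      omega
    obtain ⟨u, hu, hue⟩ : ∃ u, ∃ hu : u ∈ A M, ∀ h : e ∈ P,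
        ¬ H.Reachable ⟨u, hAP M hu⟩ ⟨e, h⟩ := by
      obtain ⟨x, hx, y, hy, hxy⟩ : ∃ x ∈ A M, ∃ y ∈ A M, x ≠ y := by
        apply Finset.one_lt_card.mp
        have := hA1 M
        have := Finset.card_pos.mpr (Finset.nonempty_iff_ne_empty.mpr hlast)
        omega
      by_contra! hcon
      obtain ⟨_, h1⟩ := hcon x hx
      obtain ⟨_, h2⟩ := hcon y hy
      exact hfar hx hy hxy (h1.trans h2.symm)
    have hne : ∀ {z : V} (hz : z ∈ P), H.Reachable ⟨u, hAP M hu⟩ ⟨z, hz⟩ → z ≠ e := by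
      rintro z hz hr rfl
      exact hue hz hr
    obtain ⟨j, hjM, huj⟩ := he u (hne (hAP M hu) (SimpleGraph.Reachable.refl _)) M hu
    have hlt : ∀ {k : ℕ} {z : V}, k ≠ M → z ∈ A k → k < M := by
      intro k z hk hz
      by_contra h
      rw [hAM k (by omega)] at hz
      simp at hz
    let A' : ℕ → Finset V := fun k =>
      (A k).filter fun z => k < M ∧ ∃ hz : z ∈ P, H.Reachable ⟨u, hAP M hu⟩ ⟨z, hz⟩
    have hempty := ih hS' A' (fun k => (Finset.filter_subset _ _).trans (hAS k))
      (fun k => (Finset.filter_subset _ _).trans (hAP k))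
      (fun k hk => Finset.filter_eq_empty_iff.mpr fun z _ h => by omega)
      (fun k hk => by
        have hne' : (A' k).Nonempty := Finset.card_pos.mp (by omega)
        obtain ⟨z, hz⟩ := hne'
        obtain ⟨hz, hkM, hzP, hr⟩ := Finset.mem_filter.mp hz
        have : A' k = A k := Finset.filter_true_of_mem fun w hw =>
          ⟨hkM, hAP k hw, hr.trans (hadj hz hw hkM)⟩
        exact hA1 k (this ▸ hk)) u
      (fun x hxu k hx => by
        obtain ⟨hx, hkM, hxP, hr⟩ := Finset.mem_filter.mp hx
        obtain ⟨l, hlk, hxl⟩ := he x (hne hxP hr) k hx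
        refine ⟨l, hlk, Finset.mem_filter.mpr ⟨hxl, hlt ?_ hxl, hxP, hr⟩⟩
        rintro rfl
        exact hfar hu hxl hxu.symm hr) j
    have : u ∈ A' j := Finset.mem_filter.mpr
      ⟨huj, hlt hjM huj, hAP M hu, SimpleGraph.Reachable.refl _⟩
    rw [hempty] at this
    simp at this

/-- In a graph of maximum degree at most `D`, walks of length at most `k` from a vertex
reach at most `(D + 1) ^ k` vertices. -/
theorem SimpleGraph.exists_finset_walk_end {V : Type*} (G : SimpleGraph V) {D : ℕ}
    (N : V → Finset V) (hN : ∀ x y, G.Adj x y → y ∈ N x) (hD : ∀ x, (N x).card ≤ D)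
    (k : ℕ) (x : V) : ∃ B : Finset V, B.card ≤ (D + 1) ^ k ∧
      ∀ y, ∀ p : G.Walk x y, p.length ≤ k → y ∈ B := by
  classical
  induction k generalizing x with
  | zero =>
    refine ⟨{x}, by simp, fun y p hp => ?_⟩
    cases p with
    | nil => simp
    | cons => simp at hp
  | succ k ih =>
    choose B hB hBw using ih
    refine ⟨(insert x (N x)).biUnion B, ?_, fun y p hp => ?_⟩
    · calc _ ≤ (insert x (N x)).card * (D + 1) ^ k :=
            Finset.card_biUnion_le_card_mul _ _ _ fun z _ => hB z
        _ ≤ (D + 1) * (D + 1) ^ k := by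
            gcongr
            exact (Finset.card_insert_le _ _).trans (Nat.succ_le_succ (hD x))
        _ = (D + 1) ^ (k + 1) := by ring
    · rw [Finset.mem_biUnion]
      cases p with
      | nil => exact ⟨x, by simp, hBw x x .nil (by simp)⟩
      | cons h p =>
        refine ⟨_, Finset.mem_insert_of_mem (hN _ _ h), hBw _ _ p ?_⟩
        simpa using hp

/-- A large set contains `R` points, no two related by a symmetric relation with small classes. -/
theorem exists_subset_pairwise_not {V : Type*} (U : Finset V) (rel : V → V → Prop)
    (hsymm : ∀ x y, rel x y → rel y x) {b : ℕ} (hb : 0 < b)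
    (hrel : ∀ x, ∃ B : Finset V, x ∈ B ∧ B.card ≤ b ∧ ∀ y, rel x y → y ∈ B) (R : ℕ)
    (hR : R * b ≤ U.card) :
    ∃ T ⊆ U, T.card = R ∧ ∀ x ∈ T, ∀ y ∈ T, x ≠ y → ¬ rel x y := by
  classical
  choose B hxB hBb hB using hrel
  induction R with
  | zero => exact ⟨∅, by simp, by simp, by simp⟩
  | succ R ih =>
    obtain ⟨T, hTU, hT, hTr⟩ := ih (le_trans (by gcongr; omega) hR)
    have hlt : (T.biUnion B).card < U.card := by
      have := Finset.card_biUnion_le_card_mul T B b fun z _ => hBb z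
      rw [hT] at this
      rw [add_mul] at hR
      omega
    obtain ⟨v, hvU, hv⟩ := Finset.exists_mem_notMem_of_card_lt_card hlt
    have hv' : ∀ x ∈ T, v ∉ B x := fun x hx h => hv (Finset.mem_biUnion.mpr ⟨x, hx, h⟩)
    have hvT : v ∉ T := fun h => hv' v h (hxB v)
    refine ⟨insert v T, Finset.insert_subset hvU hTU,
      by rw [Finset.card_insert_of_notMem hvT, hT], ?_⟩
    intro x hx y hy hxy h
    rcases Finset.mem_insert.mp hx with hxv | hx <;> rcases Finset.mem_insert.mp hy with hyv | hy
    · exact hxy (hxv.trans hyv.symm)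
    · exact hv' y hy (hxv ▸ hB _ _ (hsymm _ _ h))
    · exact hv' x hx (hyv ▸ hB _ _ h)
    · exact hTr x hx y hy hxy h

/-- Greedy construction of a uniform family of blocks of large girth. -/
theorem exists_hasLargeGirth {V : Type*} [Fintype V] {r s Δ : ℕ} (hΔ : 0 < Δ)
    (hball : (r + 1) * (Δ * (r + 1) + 1) ^ s * 2 ≤ Fintype.card V) (M : ℕ)
    (hM : 2 * ((M - 1) * (r + 1)) ≤ Δ * Fintype.card V) :
    ∃ S : ℕ → Finset V, (∀ i < M, (S i).card = r + 1) ∧ HasLargeGirth S s M := by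
  classical
  suffices h : ∃ S : ℕ → Finset V, (∀ i < M, (S i).card = r + 1) ∧ HasLargeGirth S s M ∧
      ∀ x, ((Finset.range M).filter fun i => x ∈ S i).card ≤ Δ by
    obtain ⟨S, h1, h2, -⟩ := h
    exact ⟨S, h1, h2⟩
  induction M with
  | zero => exact ⟨fun _ => ∅, by simp, fun i hi => by simp at hi, by simp⟩
  | succ M ih =>
    obtain ⟨S, hcard, hS, hdeg⟩ := ih (le_trans (by gcongr; omega) hM)
    rw [Nat.add_sub_cancel] at hM
    let deg : V → ℕ := fun x => ((Finset.range M).filter fun i => x ∈ S i).card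
    let U : Finset V := Finset.univ.filter fun x => deg x < Δ
    let N : V → Finset V := fun x => ((Finset.range M).filter fun i => x ∈ S i).biUnion S
    obtain ⟨T, hTU, hT, hTfar⟩ := exists_subset_pairwise_not U
      (fun x y => ∃ p : (blockGraph S M).Walk x y, p.length ≤ s)
      (fun x y ⟨p, hp⟩ => ⟨p.reverse, by simpa using hp⟩)
      (b := (Δ * (r + 1) + 1) ^ s) (by positivity)
      (fun x => by
        obtain ⟨B, hB, hBw⟩ := (blockGraph S M).exists_finset_walk_end (D := Δ * (r + 1)) N
          (fun x y ⟨_, j, hj, hx, hy⟩ => Finset.mem_biUnion.mpr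
            ⟨j, Finset.mem_filter.mpr ⟨Finset.mem_range.mpr hj, hx⟩, hy⟩)
          (fun x => (Finset.card_biUnion_le_card_mul _ _ (r + 1) fun j hj =>
            (hcard j (Finset.mem_range.mp (Finset.mem_filter.mp hj).1)).le).trans
              (Nat.mul_le_mul_right _ (hdeg x))) s x
        exact ⟨B, hBw x .nil (by simp), hB, fun y ⟨p, hp⟩ => hBw y p hp⟩) (r + 1) (by
        have hsum : ∑ x, deg x = M * (r + 1) := by
          simp only [deg, Finset.card_filter]
          rw [Finset.sum_comm]
          simp only [← Finset.card_filter, Finset.filter_univ_mem]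
          rw [Finset.sum_congr rfl fun i hi => hcard i (Finset.mem_range.mp hi)]
          simp
        have hhigh : (Finset.univ.filter fun x => ¬ deg x < Δ).card * Δ ≤ M * (r + 1) := by
          rw [← hsum, ← smul_eq_mul]
          refine (Finset.card_nsmul_le_sum _ deg Δ fun x hx => ?_).trans
            (Finset.sum_le_sum_of_subset (Finset.filter_subset _ _))
          simpa using hx
        have hadd := Finset.card_filter_add_card_filter_not (s := (Finset.univ : Finset V))
          (fun x => deg x < Δ)
        rw [Finset.card_univ] at hadd
        change U.card + _ = _ at hadd
        have : 2 * (Finset.univ.filter fun x => ¬ deg x < Δ).card ≤ Fintype.card V := by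
          refine Nat.le_of_mul_le_mul_left ?_ hΔ
          linarith
        omega)
    let S' : ℕ → Finset V := Function.update S M T
    have hSlt : ∀ i, i < M → S' i = S i := fun i hi => Function.update_of_ne hi.ne _ _
    have hSM : S' M = T := Function.update_self _ _ _
    have hgraph : ∀ i, i ≤ M → blockGraph S' i = blockGraph S i := by
      intro i hi
      ext x y
      refine and_congr_right fun _ => exists_congr fun j => and_congr_right fun hj => ?_
      rw [hSlt j (by omega)]
    refine ⟨S', fun i hi => ?_, fun i hi => ?_, fun x => ?_⟩
    · rcases (Nat.lt_succ_iff.mp hi).eq_or_lt with rfl | hi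
      · rw [hSM, hT]
      · rw [hSlt i hi, hcard i hi]
    · rw [hgraph i (Nat.lt_succ_iff.mp hi)]
      rcases (Nat.lt_succ_iff.mp hi).eq_or_lt with rfl | hi
      · rw [hSM]
        intro x hx y hy hxy p
        by_contra hp
        exact hTfar x hx y hy hxy ⟨p, not_lt.mp hp⟩
      · rw [hSlt i hi]
        exact hS i hi
    · have hfilter : ((Finset.range M).filter fun i => x ∈ S' i) =
          (Finset.range M).filter fun i => x ∈ S i :=
        Finset.filter_congr fun i hi => by rw [hSlt i (Finset.mem_range.mp hi)]
      rw [Finset.range_add_one, Finset.filter_insert, hfilter, hSM]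
      split_ifs with hx
      · have := (Finset.mem_filter.mp (hTU hx)).2
        exact (Finset.card_insert_le _ _).trans this
      · exact hdeg x

/-- The code whose parity checks are the sums over the blocks `{i | blk i = j}` and the power sums
`∑ i, c i * pt i ^ l` for `1 ≤ l ≤ h`. -/
def blockCode {F : Type*} [Field F] {n M : ℕ} (blk : Fin n → Fin M) (pt : Fin n → F) (h : ℕ) :
    Submodule F (Fin n → F) :=
  LinearMap.ker (((Matrix.of fun (j : Fin M) i => if blk i = j then (1 : F) else 0).mulVecLin).prod
    ((Matrix.of fun (l : Fin h) i => pt i ^ (l.val + 1)).mulVecLin))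

section blockCode

variable {F : Type*} [Field F] {n M : ℕ} {blk : Fin n → Fin M} {pt : Fin n → F} {h : ℕ}

theorem mem_blockCode {c : Fin n → F} : c ∈ blockCode blk pt h ↔
    (∀ j, ∑ i, (if blk i = j then c i else 0) = 0) ∧
      ∀ l : Fin h, ∑ i, pt i ^ (l.val + 1) * c i = 0 := by
  simp [blockCode, LinearMap.mem_ker, funext_iff, Matrix.mulVec, dotProduct]

theorem le_finrank_blockCode : n ≤ Module.finrank F (blockCode blk pt h) + (M + h) := by
  have hrank := LinearMap.finrank_range_add_finrank_ker
    (((Matrix.of fun (j : Fin M) i => if blk i = j then (1 : F) else 0).mulVecLin).prod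
      ((Matrix.of fun (l : Fin h) i => pt i ^ (l.val + 1)).mulVecLin))
  have hle := Submodule.finrank_le (LinearMap.range
    (((Matrix.of fun (j : Fin M) i => if blk i = j then (1 : F) else 0).mulVecLin).prod
      ((Matrix.of fun (l : Fin h) i => pt i ^ (l.val + 1)).mulVecLin)))
  rw [Module.finrank_prod, Module.finrank_fin_fun, Module.finrank_fin_fun] at hle
  rw [Module.finrank_fin_fun] at hrank
  change _ + Module.finrank F (blockCode blk pt h) = n at hrank
  omega

theorem hasLocality_blockCode [DecidableEq F] {r : ℕ}
    (hblk : ∀ j, (Finset.univ.filter fun i => blk i = j).card ≤ r + 1) :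
    HasLocality (blockCode blk pt h) r := by
  intro i
  refine ⟨fun i' => if blk i' = blk i then 1 else 0, fun c hc => ?_, by simp, ?_⟩
  · simpa using (mem_blockCode.mp hc).1 (blk i)
  · refine le_trans (le_of_eq ?_) (hblk (blk i))
    simp [hammingNorm]

theorem sum_eval_eq_zero_of_mem_blockCode {c : Fin n → F} (hc : c ∈ blockCode blk pt h)
    {p : Polynomial F} (hp : p.natDegree ≤ h) : ∑ i, p.eval (pt i) * c i = 0 := by
  obtain ⟨hblock, hpow⟩ := mem_blockCode.mp hc
  have hmono : ∀ l ≤ h, ∑ i, pt i ^ l * c i = 0 := by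
    intro l hl
    rcases l with _ | l
    · have hsum : ∑ j, ∑ i, (if blk i = j then c i else 0) = 0 :=
        Finset.sum_eq_zero fun j _ => hblock j
      rw [Finset.sum_comm] at hsum
      simpa using hsum
    · exact hpow ⟨l, hl⟩
  simp only [Polynomial.eval_eq_sum_range, Finset.sum_mul]
  rw [Finset.sum_comm]
  refine Finset.sum_eq_zero fun l hl => ?_
  simp only [mul_assoc]
  rw [← Finset.mul_sum, hmono l (by have := Finset.mem_range.mp hl; omega), mul_zero]

/-- A codeword of weight at most `h + 1` sums to zero over each fibre of `pt`. -/
theorem sum_fiber_eq_zero_of_mem_blockCode [DecidableEq F] {c : Fin n → F}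
    (hc : c ∈ blockCode blk pt h) (hw : hammingNorm c ≤ h + 1) (x : F) :
    ∑ i, (if pt i = x then c i else 0) = 0 := by
  let Q : Finset F := (Finset.univ.filter fun i => c i ≠ 0).image pt
  have hQ : Q.card ≤ h + 1 := Finset.card_image_le.trans hw
  have hzero : ∀ i, pt i ∉ Q → c i = 0 := fun i hi => by
    by_contra hci
    exact hi (Finset.mem_image_of_mem pt (by simpa using hci))
  by_cases hx : x ∈ Q
  · let p : Polynomial F := ∏ y ∈ Q.erase x, (Polynomial.X - Polynomial.C y)
    have hp : p.natDegree ≤ h := by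
      rw [Polynomial.natDegree_finsetProd_X_sub_C_eq_card, Finset.card_erase_of_mem hx]
      omega
    have hpx : p.eval x ≠ 0 := by
      rw [Polynomial.eval_prod, Finset.prod_ne_zero_iff]
      intro y hy
      simpa [sub_eq_zero] using (Finset.ne_of_mem_erase hy).symm
    have hsum := sum_eval_eq_zero_of_mem_blockCode hc hp
    have hterm : ∀ i, p.eval (pt i) * c i = p.eval x * if pt i = x then c i else 0 := by
      intro i
      split_ifs with hi
      · rw [hi]
      · by_cases hiQ : pt i ∈ Q
        · have : p.eval (pt i) = 0 := by
            rw [Polynomial.eval_prod]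
            exact Finset.prod_eq_zero (Finset.mem_erase.mpr ⟨hi, hiQ⟩) (by simp)
          rw [this, zero_mul, mul_zero]
        · rw [hzero i hiQ, mul_zero, mul_zero]
    rw [Finset.sum_congr rfl fun i _ => hterm i, ← Finset.mul_sum] at hsum
    exact (mul_eq_zero.mp hsum).resolve_left hpx
  · refine Finset.sum_eq_zero fun i _ => ?_
    split_ifs with hi
    · exact hzero i (hi ▸ hx)
    · rfl

theorem exists_ne_of_sum_ite_eq_zero {ι G : Type*} [Fintype ι] [AddCommMonoid G] {c : ι → G}
    {P : ι → Prop} [DecidablePred P] (hsum : ∑ i, (if P i then c i else 0) = 0) {i : ι}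
    (hi : P i) (hci : c i ≠ 0) : ∃ i', i' ≠ i ∧ P i' ∧ c i' ≠ 0 := by
  by_contra! hcon
  rw [Finset.sum_eq_single i (fun i' _ hne => by
    split_ifs with hP
    · exact hcon i' hne hP
    · rfl) (by simp), if_pos hi] at hsum
  exact hci hsum

theorem lt_hammingNorm_of_mem_blockCode [DecidableEq F] {S : ℕ → Finset F} {s : ℕ}
    (hs : h ≤ 2 * s + 2) (hS : HasLargeGirth S s M) (hpt : ∀ i, pt i ∈ S (blk i))
    (hinj : ∀ i i', blk i = blk i' → pt i = pt i' → i = i') {c : Fin n → F}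
    (hc : c ∈ blockCode blk pt h) (hc0 : c ≠ 0) : h + 1 < hammingNorm c := by
  by_contra! hw
  have hblock := (mem_blockCode.mp hc).1
  have hfiber := sum_fiber_eq_zero_of_mem_blockCode hc hw
  let W : Finset (Fin n) := Finset.univ.filter fun i => c i ≠ 0
  have hW : ∀ {i}, i ∈ W ↔ c i ≠ 0 := by simp [W]
  let A : ℕ → Finset F := fun j => (W.filter fun i => (blk i : ℕ) = j).image pt
  have hA : ∀ {j x}, x ∈ A j ↔ ∃ i, (c i ≠ 0 ∧ (blk i : ℕ) = j) ∧ pt i = x := by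
    simp [A, W]
  have hP : (W.image pt).card ≤ s + 1 := by
    have h2 : 2 * (W.image pt).card ≤ W.card := by
      refine Finset.mul_card_image_le_card W 2 fun x hx => ?_
      obtain ⟨i, hi, rfl⟩ := Finset.mem_image.mp hx
      obtain ⟨i', hne, hpi, hci⟩ := exists_ne_of_sum_ite_eq_zero (P := fun k => pt k = pt i)
        (hfiber (pt i)) rfl (hW.mp hi)
      exact Finset.one_lt_card.mpr ⟨i, Finset.mem_filter.mpr ⟨hi, rfl⟩, i',
        Finset.mem_filter.mpr ⟨hW.mpr hci, hpi⟩, hne.symm⟩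
    have : W.card ≤ h + 1 := hw
    omega
  have hempty := hS.subfamily_eq_empty hP M A
    (fun j x hx => by
      obtain ⟨i, ⟨_, rfl⟩, rfl⟩ := hA.mp hx
      exact hpt i)
    (fun j => Finset.image_subset_image (Finset.filter_subset _ _))
    (fun j hj => by
      refine Finset.eq_empty_of_forall_notMem fun x hx => ?_
      obtain ⟨i, ⟨_, rfl⟩, rfl⟩ := hA.mp hx
      exact absurd (blk i).isLt (not_lt.mpr hj))
    (fun j hj => by
      obtain ⟨x, hx⟩ := Finset.card_eq_one.mp hj
      obtain ⟨i, ⟨hci, rfl⟩, rfl⟩ := hA.mp (hx ▸ Finset.mem_singleton_self x)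
      obtain ⟨i', hne, hbi, hci'⟩ := exists_ne_of_sum_ite_eq_zero (P := fun k => blk k = blk i)
        (hblock (blk i)) rfl hci
      have : pt i' ∈ A (blk i) := hA.mpr ⟨i', ⟨hci', by rw [hbi]⟩, rfl⟩
      rw [hx, Finset.mem_singleton] at this
      exact hne (hinj _ _ hbi this)) 0
    (fun x _ j hx => by
      obtain ⟨i, ⟨hci, rfl⟩, rfl⟩ := hA.mp hx
      obtain ⟨i', hne, hpi, hci'⟩ := exists_ne_of_sum_ite_eq_zero (P := fun k => pt k = pt i)
        (hfiber (pt i)) rfl hci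
      exact ⟨blk i', fun hb => hne (hinj _ _ (Fin.ext hb) hpi), hA.mpr ⟨i', ⟨hci', rfl⟩, hpi⟩⟩)
  obtain ⟨i, hi⟩ := Function.ne_iff.mp hc0
  have : pt i ∈ A (blk i) := hA.mpr ⟨i, ⟨hi, rfl⟩, rfl⟩
  rw [hempty] at this
  simp at this

end blockCode

/-- The degree bound `2 * n / q + 1` meets the hypothesis of `exists_hasLargeGirth` on the size
of balls. -/
theorem greedy_parameters {r s q n : ℕ} (hs : 1 ≤ s) (hq : 0 < q) (hqn : q ≤ n)
    (hn : (n : ℝ) ≤ 1 / (12 * ((r : ℝ) + 1) ^ 2) * (q : ℝ) ^ ((1 : ℝ) + 1 / (s : ℝ))) :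
    (r + 1) * ((2 * n / q + 1) * (r + 1) + 1) ^ s * 2 ≤ q := by
  have hqR : (0 : ℝ) < q := by exact_mod_cast hq
  have hqnR : (q : ℝ) ≤ n := by exact_mod_cast hqn
  set t : ℝ := (q : ℝ) ^ (1 / (s : ℝ)) with ht
  have ht0 : 0 < t := by positivity
  have hts : t ^ s = q := by
    rw [ht, one_div, Real.rpow_inv_natCast_pow hqR.le (by omega)]
  rw [Real.rpow_add hqR, Real.rpow_one, ← ht] at hn
  have hΔ : ((2 * n / q + 1 : ℕ) : ℝ) ≤ 3 * (n / q) := by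
    push_cast
    have h1 : ((2 * n / q : ℕ) : ℝ) ≤ 2 * (n / q) := by
      refine Nat.cast_div_le.trans (le_of_eq ?_)
      push_cast
      ring
    have h2 : (1 : ℝ) ≤ n / q := (one_le_div hqR).mpr hqnR
    linarith
  have hnq : (n : ℝ) / q ≤ t / (12 * ((r : ℝ) + 1) ^ 2) := by
    rw [div_le_iff₀ hqR]
    refine hn.trans (le_of_eq ?_)
    ring
  have hbase : (((2 * n / q + 1) * (r + 1) + 1 : ℕ) : ℝ) ≤ t / (2 * ((r : ℝ) + 1)) := by
    have h1 : (1 : ℝ) ≤ ((2 * n / q + 1 : ℕ) : ℝ) * (r + 1) := by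
      exact_mod_cast Nat.mul_pos (Nat.succ_pos _) (Nat.succ_pos r)
    calc (((2 * n / q + 1) * (r + 1) + 1 : ℕ) : ℝ)
        = ((2 * n / q + 1 : ℕ) : ℝ) * (r + 1) + 1 := by push_cast; ring
      _ ≤ 2 * (((2 * n / q + 1 : ℕ) : ℝ) * (r + 1)) := by linarith
      _ ≤ 2 * (3 * (t / (12 * ((r : ℝ) + 1) ^ 2)) * (r + 1)) := by
          gcongr
          linarith
      _ = t / (2 * ((r : ℝ) + 1)) := by field_simp; norm_num
  have hpow : (2 * ((r : ℝ) + 1)) ≤ (2 * ((r : ℝ) + 1)) ^ s :=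
    le_self_pow₀ (by linarith [(Nat.cast_nonneg r : (0 : ℝ) ≤ r)]) (by omega)
  have : (((r + 1) * ((2 * n / q + 1) * (r + 1) + 1) ^ s * 2 : ℕ) : ℝ) ≤ q := by
    calc (((r + 1) * ((2 * n / q + 1) * (r + 1) + 1) ^ s * 2 : ℕ) : ℝ)
        = 2 * ((r : ℝ) + 1) * (((2 * n / q + 1) * (r + 1) + 1 : ℕ) : ℝ) ^ s := by
          push_cast; ring
      _ ≤ 2 * ((r : ℝ) + 1) * (t / (2 * ((r : ℝ) + 1))) ^ s := by gcongr
      _ = 2 * ((r : ℝ) + 1) * (q / (2 * ((r : ℝ) + 1)) ^ s) := by rw [div_pow, hts]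
      _ ≤ q := by
          rw [← mul_div_assoc, div_le_iff₀ (by positivity), mul_comm]
          gcongr
  exact_mod_cast this

/-- For `5 ≤ d ≤ r+2` and `2 ≤ a ≤ d-1` there is a constant `η = η(d,r) > 0` such that
over any finite field of size `q`, for any `n ≡ a (mod r+1)` with
`q(r+1) < n ≤ η·q^{1+1/⌊(d-3)/2⌋}`, there exists an optimal LRC of length `n`, locality
`r`, dimension `k ≥ n - ⌈n/(r+1)⌉ - (d-2)` and all nonzero weights
`≥ max(d, n - k - ⌈k/r⌉ + 1)`. -/
theorem stmt_14 {d r a : ℕ} (hd5 : 5 ≤ d) (hdr : d ≤ r + 2)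
    (ha1 : 2 ≤ a) (ha2 : a ≤ d - 1) :
    ∃ η : ℝ, 0 < η ∧
      ∀ (F : Type) [Field F] [Fintype F] [DecidableEq F] (n : ℕ), 0 < n →
        n % (r + 1) = a → Fintype.card F * (r + 1) < n →
        (n : ℝ) ≤ η * (Fintype.card F : ℝ) ^
          ((1 : ℝ) + 1 / ((((d - 3) / 2 : ℕ) : ℝ))) →
        ∃ C : Submodule F (Fin n → F),
          HasLocality C r ∧
          ((n : ℤ) - ⌈(n : ℚ) / ((r : ℚ) + 1)⌉ - ((d : ℤ) - 2) ≤
            (Module.finrank F ↥C : ℤ)) ∧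
          (∀ c ∈ C, c ≠ 0 → d ≤ hammingNorm c) ∧
          (∀ c ∈ C, c ≠ 0 →
            (n : ℤ) - (Module.finrank F ↥C : ℤ) -
                ⌈(Module.finrank F ↥C : ℚ) / (r : ℚ)⌉ + 1 ≤ (hammingNorm c : ℤ)) := by
  have hs : 1 ≤ (d - 3) / 2 := by omega
  generalize hsd : (d - 3) / 2 = s at hs
  refine ⟨1 / (12 * ((r : ℝ) + 1) ^ 2), by positivity, fun F _ _ _ n _ hna hqn hn => ?_⟩
  set q := Fintype.card F with hq
  have hq0 : 0 < q := Fintype.card_pos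
  obtain ⟨S, hcard, hS⟩ := exists_hasLargeGirth (V := F) (r := r) (s := s) (Δ := 2 * n / q + 1)
    (Nat.succ_pos _) (greedy_parameters hs hq0 (by nlinarith) hn) (n / (r + 1) + 1) (by
      rw [← hq, Nat.add_sub_cancel]
      have h1 := Nat.div_mul_le_self n (r + 1)
      have h2 := Nat.lt_div_mul_add hq0 (a := 2 * n)
      nlinarith)
  have hblk : ∀ i : Fin n, i.val / (r + 1) < n / (r + 1) + 1 := fun i =>
    Nat.lt_succ_of_le (Nat.div_le_div_right i.isLt.le)
  let blk : Fin n → Fin (n / (r + 1) + 1) := fun i => ⟨i.val / (r + 1), hblk i⟩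
  let pt : Fin n → F := fun i => ((S (blk i)).equivFinOfCardEq (hcard _ (blk i).isLt)).symm
    ⟨i.val % (r + 1), Nat.mod_lt _ (Nat.succ_pos r)⟩
  have hmod : ∀ i i', blk i = blk i' → i.val % (r + 1) = i'.val % (r + 1) → i = i' := by
    intro i i' hb hm
    have hb : i.val / (r + 1) = i'.val / (r + 1) := congrArg Fin.val hb
    rw [Fin.ext_iff, ← Nat.div_add_mod i.val (r + 1), hb, hm, Nat.div_add_mod]
  have hinj : ∀ i i', blk i = blk i' → pt i = pt i' → i = i' := by
    intro i i' hb hp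
    refine hmod i i' hb ?_
    have key : ∀ (j j' : Fin (n / (r + 1) + 1)) (k k' : Fin (r + 1)), j = j' →
        (((S j).equivFinOfCardEq (hcard _ j.isLt)).symm k : F) =
          ((S j').equivFinOfCardEq (hcard _ j'.isLt)).symm k' → k = k' := by
      rintro j _ k k' rfl hk
      exact (Equiv.injective _) (Subtype.ext hk)
    exact congrArg Fin.val (key _ _ _ _ hb hp)
  have hdist : ∀ c ∈ blockCode blk pt (d - 2), c ≠ 0 → d ≤ hammingNorm c := fun c hc hc0 => by
    have := lt_hammingNorm_of_mem_blockCode (by omega) hS (fun i => Subtype.prop _) hinj hc hc0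
    omega
  have hdim := le_finrank_blockCode (blk := blk) (pt := pt) (h := d - 2)
  set k := Module.finrank F (blockCode blk pt (d - 2))
  have hdiv := Nat.div_add_mod n (r + 1)
  rw [hna] at hdiv
  have hceil : ⌈(n : ℚ) / ((r : ℚ) + 1)⌉ = (n / (r + 1) : ℕ) + 1 := by
    have ha : a < r + 1 := hna ▸ Nat.mod_lt n (Nat.succ_pos r)
    have hnQ : (n : ℚ) = (r + 1) * (n / (r + 1) : ℕ) + a := by exact_mod_cast hdiv.symm
    have haQ : (a : ℚ) < r + 1 := by exact_mod_cast ha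
    have ha0 : (0 : ℚ) < a := by exact_mod_cast (by omega : 0 < a)
    generalize n / (r + 1) = m at hnQ ⊢
    rw [Int.ceil_eq_iff, lt_div_iff₀ (by positivity), div_le_iff₀ (by positivity)]
    push_cast
    constructor <;> nlinarith
  have hceil_k : ((n / (r + 1) : ℕ) : ℤ) ≤ ⌈(k : ℚ) / (r : ℚ)⌉ := by
    have hr : (0 : ℚ) < r := by exact_mod_cast (by omega : 0 < r)
    have hk : r * (n / (r + 1)) < k + r := by nlinarith [Nat.sub_add_cancel (by omega : 2 ≤ d)]
    have hkQ : (r : ℚ) * (n / (r + 1) : ℕ) < k + r := by exact_mod_cast hk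
    generalize n / (r + 1) = m at hkQ ⊢
    rw [← Int.sub_one_lt_iff, Int.lt_ceil, lt_div_iff₀ hr]
    push_cast at hkQ ⊢
    nlinarith
  refine ⟨blockCode blk pt (d - 2), hasLocality_blockCode fun j => ?_, ?_, hdist,
    fun c hc hc0 => ?_⟩
  · calc _ ≤ (Finset.range (r + 1)).card :=
          Finset.card_le_card_of_injOn (fun i => i.val % (r + 1))
            (fun i _ => by simpa using Nat.mod_lt _ (Nat.succ_pos r))
            (fun i hi i' hi' hm => hmod i i'
              ((by simpa using hi : blk i = j).trans (by simpa using hi' : blk i' = j).symm) hm)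
      _ = r + 1 := Finset.card_range _
  · rw [hceil]
    omega
  · change (n : ℤ) - (k : ℤ) - ⌈(k : ℚ) / (r : ℚ)⌉ + 1 ≤ _
    have := hdist c hc hc0
    omega
end

section
/- Let F be a field, let r, ℓ ≥ 1 be integers, let d ∈ {3,4}, and let α : Fin (r+1) → F be injective. For (i,j) ∈ Fin ℓ × Fin (r+1), define h(i,j) ∈ (Fin ℓ → F) × (Fin (d-2) → F) by h(i,j) = (Pi.single i 1, fun m => (α j)^(m+1)), where m ranges over Fin (d-2). Then every subfamily of at most d-1 distinct vectors h(i,j) is linearly independent over F. -/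
/-- A weight function on a finite set of distinct nodes in a field vanishes as soon as its moments
of order less than the number of nodes vanish. -/
theorem eq_zero_of_forall_sum_mul_pow_eq_zero {ι F : Type*} [Field F] {T : Finset ι} {x g : ι → F}
    (hx : Set.InjOn x T) (h : ∀ k < T.card, ∑ q ∈ T, g q * x q ^ k = 0) :
    ∀ p ∈ T, g p = 0 := by
  classical
  intro p hp
  set P := Lagrange.nodal (T.erase p) x with hP
  have hdeg : P.natDegree < T.card := by
    rw [hP, Lagrange.natDegree_nodal]
    exact Finset.card_erase_lt_of_mem hp
  have hsum : ∑ q ∈ T, g q * P.eval (x q) = 0 := by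
    simp_rw [Polynomial.eval_eq_sum_range' hdeg, Finset.mul_sum]
    rw [Finset.sum_comm]
    refine Finset.sum_eq_zero fun k hk => ?_
    simp_rw [mul_left_comm (g _), ← Finset.mul_sum]
    rw [h k (Finset.mem_range.1 hk), mul_zero]
  rw [Finset.sum_eq_single_of_mem p hp fun q hq hqp => by
    rw [hP, Lagrange.eval_nodal_at_node (Finset.mem_erase.2 ⟨hqp, hq⟩), mul_zero]] at hsum
  refine (mul_eq_zero.1 hsum).resolve_right ?_
  rw [hP, Lagrange.eval_nodal]
  refine Finset.prod_ne_zero_iff.2 ?_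
  intro q hq
  obtain ⟨hqp, hq⟩ := Finset.mem_erase.1 hq
  exact sub_ne_zero.2 fun he => hqp (hx hq hp he.symm)

/-- If nonzero weights on at most three points sum to zero over every fibre of `f`, then
the points all lie in a single fibre. -/
theorem eq_of_forall_sum_fiber_eq_zero {ι κ F : Type*} [DecidableEq κ] [AddCommMonoid F]
    {T : Finset ι} {f : ι → κ} {g : ι → F} (hT : T.card ≤ 3) (hg : ∀ q ∈ T, g q ≠ 0)
    (h : ∀ i, ∑ q ∈ T with f q = i, g q = 0) : ∀ p ∈ T, ∀ q ∈ T, f p = f q := by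
  classical
  have two_le : ∀ p ∈ T, 2 ≤ (T.filter (f · = f p)).card := by
    intro p hp
    have hmem : p ∈ T.filter (f · = f p) := Finset.mem_filter.2 ⟨hp, rfl⟩
    by_contra! hlt
    have hone : (T.filter (f · = f p)).card = 1 :=
      le_antisymm (Nat.le_of_lt_succ hlt) (Finset.card_pos.2 ⟨p, hmem⟩)
    obtain ⟨a, ha⟩ := Finset.card_eq_one.1 hone
    obtain rfl : p = a := by simpa [ha] using hmem
    have := h (f p)
    rw [ha, Finset.sum_singleton] at this
    exact hg p hp this
  intro p hp q hq
  by_contra hpq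
  have hdisj : Disjoint (T.filter (f · = f p)) (T.filter (f · = f q)) :=
    Finset.disjoint_filter.2 fun _ _ h₁ h₂ => hpq (h₁.symm.trans h₂)
  have hle := Finset.card_le_card
    (Finset.union_subset (Finset.filter_subset (f · = f p) T) (Finset.filter_subset (f · = f q) T))
  rw [Finset.card_union_of_disjoint hdisj] at hle
  have := two_le p hp
  have := two_le q hq
  omega

/-- For `d ∈ {3,4}` and injective `α : Fin (r+1) → F`, any `d-1` distinct columns
`h(i,j) = (e_i, ((α j)^(m+1))_m)` are linearly independent. -/
theorem stmt_15 {F : Type*} [Field F] {r ℓ d : ℕ} (hr : 1 ≤ r) (hℓ : 1 ≤ ℓ)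
    (hd : d = 3 ∨ d = 4) (α : Fin (r + 1) → F) (hα : Function.Injective α) :
    ∀ s : Finset (Fin ℓ × Fin (r + 1)), s.card ≤ d - 1 →
      LinearIndependent F
        (fun p : {x // x ∈ s} =>
          ((Pi.single p.1.1 (1 : F) : Fin ℓ → F),
            (fun m : Fin (d - 2) => (α p.1.2) ^ ((m : ℕ) + 1)))) := by
  classical
  intro s hs
  change LinearIndepOn F (fun p : Fin ℓ × Fin (r + 1) =>
    ((Pi.single p.1 (1 : F) : Fin ℓ → F), (fun m : Fin (d - 2) => (α p.2) ^ ((m : ℕ) + 1))))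
    (s : Set (Fin ℓ × Fin (r + 1)))
  rw [linearIndepOn_finset_iff]
  intro g hg
  have hfst (i : Fin ℓ) : ∑ q ∈ s with q.1 = i, g q = 0 := by
    have := congrFun (congrArg Prod.fst hg) i
    simpa [Prod.fst_sum, Finset.sum_apply, Pi.single_apply, Finset.sum_filter, eq_comm] using this
  have hsnd (k : ℕ) (hk : k < d - 2) : ∑ q ∈ s, g q * α q.2 ^ (k + 1) = 0 := by
    have := congrFun (congrArg Prod.snd hg) ⟨k, hk⟩
    simpa [Prod.snd_sum, Finset.sum_apply] using this
  set T := s.filter (g · ≠ 0) with hT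
  have hcard : T.card ≤ d - 1 := (Finset.card_filter_le _ _).trans hs
  have hfiber : ∀ p ∈ T, ∀ q ∈ T, p.1 = q.1 := by
    refine eq_of_forall_sum_fiber_eq_zero (g := g) (by omega)
      (fun q hq => (Finset.mem_filter.1 hq).2) fun i => ?_
    rw [hT, Finset.filter_comm, Finset.sum_filter_ne_zero, hfst]
  have hinj : Set.InjOn (fun q : Fin ℓ × Fin (r + 1) => α q.2) T := fun p hp q hq h =>
    Prod.ext (hfiber p hp q hq) (hα h)
  have hmoment : ∀ k < T.card, ∑ q ∈ T, g q * α q.2 ^ k = 0 := by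
    intro k hk
    have hfilter : ∑ q ∈ T, g q * α q.2 ^ k = ∑ q ∈ s, g q * α q.2 ^ k :=
      Finset.sum_filter_of_ne fun q _ hq => left_ne_zero_of_mul hq
    rw [hfilter]
    cases k with
    | zero =>
      simp only [pow_zero, mul_one]
      rw [← Finset.sum_fiberwise s Prod.fst g]
      exact Finset.sum_eq_zero fun i _ => hfst i
    | succ k => exact hsnd k (by omega)
  intro p hp
  by_contra hne
  exact hne (eq_zero_of_forall_sum_mul_pow_eq_zero hinj hmoment p (Finset.mem_filter.2 ⟨hp, hne⟩))
end

section
/- Let F be a finite field with q = |F| ≥ 2, let h, t, N be positive integers with N ≥ 2t, and let w : Fin N → (Fin h → F) be a family of vectors such that every subfamily of 2t distinct vectors w(m) is linearly independent over F. Then, as real numbers, N ≤ t · q^(h/t) / (q - 1), where the exponent h/t is a real number. -/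
/-- The usual lower bound `(n / k) ^ k ≤ n.choose k`, with denominators cleared. -/
theorem Nat.pow_le_choose_mul_pow {n k : ℕ} (h : k ≤ n) : n ^ k ≤ n.choose k * k ^ k := by
  have key : n ^ k * k.descFactorial k ≤ n.descFactorial k * k ^ k := by
    rw [Nat.descFactorial_eq_prod_range, Nat.descFactorial_eq_prod_range]
    calc n ^ k * ∏ i ∈ Finset.range k, (k - i)
        = ∏ i ∈ Finset.range k, n * (k - i) := by simp [Finset.prod_mul_distrib]
      _ ≤ ∏ i ∈ Finset.range k, (n - i) * k := by
          refine Finset.prod_le_prod' fun i _ => ?_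
          rw [Nat.mul_sub, Nat.sub_mul, Nat.mul_comm i k]
          exact Nat.sub_le_sub_left (Nat.mul_le_mul_right i h) _
      _ = (∏ i ∈ Finset.range k, (n - i)) * k ^ k := by simp [Finset.prod_mul_distrib]
  rw [Nat.descFactorial_self, Nat.descFactorial_eq_factorial_mul_choose] at key
  refine Nat.le_of_mul_le_mul_left ?_ k.factorial_pos
  linarith

/-- If any `2 * t` of the vectors `w i` are linearly independent, then the linear combinations of
exactly `t` of them with nonzero coefficients are pairwise distinct. -/
theorem choose_mul_pow_le_card_of_linearIndependent {F ι V : Type*} [Field F] [Fintype F]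
    [Fintype ι] [AddCommGroup V] [Module F V] [Fintype V] {t : ℕ}
    (hN : 2 * t ≤ Fintype.card ι) (w : ι → V)
    (hind : ∀ s : Finset ι, s.card = 2 * t →
      LinearIndependent F (fun m : {x // x ∈ s} => w m.1)) :
    (Fintype.card ι).choose t * (Fintype.card F - 1) ^ t ≤ Fintype.card V := by
  classical
  let P := Σ s : {s : Finset ι // s.card = t}, ({x // x ∈ s.1} → Fˣ)
  let c : P → ι → F := fun p m => if h : m ∈ p.1.1 then (p.2 ⟨m, h⟩ : F) else 0
  have c_ne : ∀ p m, c p m ≠ 0 ↔ m ∈ p.1.1 := by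
    intro p m
    by_cases h : m ∈ p.1.1 <;> simp [c, h]
  have c_inj : Function.Injective c := by
    rintro ⟨⟨s, hs⟩, u⟩ ⟨⟨s', hs'⟩, u'⟩ h
    obtain rfl : s = s' := by
      ext m
      have h₁ := c_ne ⟨⟨s, hs⟩, u⟩ m
      rw [h] at h₁
      exact h₁.symm.trans (c_ne ⟨⟨s', hs'⟩, u'⟩ m)
    congr 1
    funext ⟨m, hm⟩
    simpa [c, hm, Units.ext_iff] using congrFun h m
  have inj : Function.Injective fun p => ∑ m, c p m • w m := by
    intro p p' h
    refine c_inj (sub_eq_zero.1 ?_)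
    have hcard : (p.1.1 ∪ p'.1.1).card ≤ 2 * t := by
      have := Finset.card_union_le p.1.1 p'.1.1
      rw [p.1.2, p'.1.2] at this
      lia
    obtain ⟨s, hs, hst⟩ := Finset.exists_superset_card_eq hcard hN
    have hout : ∀ m ∉ s, (c p - c p') m = 0 := by
      intro m hm
      have h₁ : c p m = 0 := by
        by_contra h
        exact hm (hs (Finset.mem_union_left _ ((c_ne _ _).1 h)))
      have h₂ : c p' m = 0 := by
        by_contra h
        exact hm (hs (Finset.mem_union_right _ ((c_ne _ _).1 h)))
      simp [h₁, h₂]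
    have hsum : ∑ m : {x // x ∈ s}, (c p - c p') m • w m = 0 := by
      rw [Finset.sum_coe_sort s (fun m => (c p - c p') m • w m),
        Finset.sum_subset s.subset_univ fun m _ hm => by rw [hout m hm, zero_smul]]
      simpa [sub_smul, sub_eq_zero] using h
    funext m
    by_cases hm : m ∈ s
    · exact Fintype.linearIndependent_iff.1 (hind s hst) (fun m => (c p - c p') m) hsum ⟨m, hm⟩
    · exact hout m hm
  have hP : Fintype.card P = (Fintype.card ι).choose t * (Fintype.card F - 1) ^ t := by
    rw [Fintype.card_sigma, Finset.sum_congr rfl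
      (g := fun _ => (Fintype.card F - 1) ^ t) fun s _ => by
        rw [Fintype.card_fun, Fintype.card_units, Fintype.card_coe, s.2]]
    simp
  exact hP ▸ Fintype.card_le_of_injective _ inj

/-- Hamming-bound consequence: if every `2t` of the vectors `w(m) ∈ F^h` are linearly
independent, then `N ≤ t · q^{h/t} / (q-1)`. -/
theorem stmt_16 {F : Type*} [Field F] [Fintype F] {h t N : ℕ}
    (hq : 2 ≤ Fintype.card F) (hh : 1 ≤ h) (ht : 1 ≤ t) (hN : 2 * t ≤ N)
    (w : Fin N → (Fin h → F))
    (hind : ∀ s : Finset (Fin N), s.card = 2 * t →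
      LinearIndependent F (fun m : {x // x ∈ s} => w m.1)) :
    (N : ℝ) ≤ (t : ℝ) * (Fintype.card F : ℝ) ^ ((h : ℝ) / (t : ℝ)) /
      ((Fintype.card F : ℝ) - 1) := by
  have hpack := choose_mul_pow_le_card_of_linearIndependent (by simpa using hN) w hind
  rw [Fintype.card_fin, Fintype.card_fun, Fintype.card_fin] at hpack
  generalize Fintype.card F = q at *
  have hnat : (N * (q - 1)) ^ t ≤ t ^ t * q ^ h := by
    calc (N * (q - 1)) ^ t = N ^ t * (q - 1) ^ t := mul_pow ..
      _ ≤ N.choose t * t ^ t * (q - 1) ^ t :=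
          Nat.mul_le_mul_right _ (Nat.pow_le_choose_mul_pow (by lia))
      _ = t ^ t * (N.choose t * (q - 1) ^ t) := by ring
      _ ≤ t ^ t * q ^ h := Nat.mul_le_mul_left _ hpack
  have hreal : ((N : ℝ) * ((q : ℝ) - 1)) ^ t ≤ (t : ℝ) ^ t * (q : ℝ) ^ h := by
    have := (Nat.cast_le (α := ℝ)).2 hnat
    push_cast [Nat.cast_sub (show 1 ≤ q by lia)] at this
    exact this
  have hq1 : (0 : ℝ) < (q : ℝ) - 1 := by
    have : (2 : ℝ) ≤ q := by exact_mod_cast hq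
    linarith
  rw [le_div_iff₀ hq1]
  refine le_of_pow_le_pow_left₀ (n := t) (by lia) (by positivity) ?_
  rwa [mul_pow (t : ℝ), ← Real.rpow_mul_natCast (by positivity), div_mul_cancel₀ _ (by positivity),
    Real.rpow_natCast]
end
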